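/- arXiv:2209.08197 — 2 statements merged into one kernel-verified Lean document; each statement's English description precedes it below -/
import Mathlib

section
/- Fix μ₁ > μ₂ and variances σ₁², σ₂² > 0, and let N > 1 be a real number. Let X, Y be independent Gaussian with means μ₁, μ₂ and variances σ₁², σ₂², and let X', Y' be independent Gaussian with means μ₁, μ₂ and variances σ₁²/N, σ₂²/N. Then P(X' > Y') > P(X > Y); i.e., scaling both variances down by the factor N strictly increases the probability of the larger-mean variable exceeding the smaller-mean one. -/
open MeasureTheory ProbabilityTheory Real

open scoped NNReal

/-- Upper tails of a nondegenerate Gaussian are strictly decreasing in the threshold. -/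
lemma gaussianReal_Ioi_strictAnti (m : ℝ) {v : ℝ≥0} (hv : v ≠ 0) :
    StrictAnti fun a : ℝ ↦ gaussianReal m v (Set.Ioi a) := by
  intro a b hab
  have hpos : 0 < gaussianReal m v (Set.Ioc a b) := by
    refine pos_iff_ne_zero.mpr fun h ↦ ?_
    have hvol := gaussianReal_absolutelyContinuous' m hv h
    rw [Real.volume_Ioc, ENNReal.ofReal_eq_zero] at hvol
    linarith
  change gaussianReal m v (Set.Ioi b) < gaussianReal m v (Set.Ioi a)
  rw [← Set.Ioc_union_Ioi_eq_Ioi hab.le,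
    measure_union (Set.Ioc_disjoint_Ioi le_rfl) measurableSet_Ioi, add_comm]
  exact ENNReal.lt_add_right (measure_ne_top _ _) hpos.ne'

/-- Standardization of the probability that a nondegenerate Gaussian is positive. -/
lemma gaussianReal_Ioi_zero (m : ℝ) {v : ℝ≥0} (hv : v ≠ 0) :
    gaussianReal m v (Set.Ioi 0) = gaussianReal 0 1 (Set.Ioi (-m / √v)) := by
  have hs : 0 < √(v : ℝ) := Real.sqrt_pos.mpr (by positivity)
  have hmap : gaussianReal m v = ((gaussianReal 0 1).map (√(v : ℝ) * ·)).map (m + ·) := by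
    rw [gaussianReal_map_const_mul, gaussianReal_map_const_add]
    congr 1
    · simp
    · ext
      simp
  rw [hmap, Measure.map_map (by fun_prop) (by fun_prop),
    Measure.map_apply (by fun_prop) measurableSet_Ioi]
  congr 1
  ext x
  simp only [Set.mem_preimage, Function.comp_apply, Set.mem_Ioi, div_lt_iff₀ hs]
  constructor <;> intro h <;> linarith

/-- For fixed positive mean, the probability that a Gaussian is positive strictly increases as
its variance decreases. -/
lemma gaussianReal_Ioi_zero_lt_of_lt {m : ℝ} (hm : 0 < m) {v w : ℝ≥0} (hv : v ≠ 0) (hvw : v < w) :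
    gaussianReal m w (Set.Ioi 0) < gaussianReal m v (Set.Ioi 0) := by
  rw [gaussianReal_Ioi_zero m hv, gaussianReal_Ioi_zero m (pos_of_gt hvw).ne']
  apply gaussianReal_Ioi_strictAnti 0 one_ne_zero
  have hs : 0 < √(v : ℝ) := Real.sqrt_pos.mpr (by positivity)
  rw [neg_div, neg_div, neg_lt_neg_iff]
  exact div_lt_div_of_pos_left hm hs (Real.sqrt_lt_sqrt v.2 hvw)

/-- The probability that one of two independent Gaussians exceeds the other. -/
lemma measure_gt_of_indepFun_gaussianReal {Ω : Type*} {mΩ : MeasurableSpace Ω} {P : Measure Ω}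
    {X Y : Ω → ℝ} (hXm : Measurable X) (hYm : Measurable Y) (hXY : IndepFun X Y P)
    {m₁ m₂ : ℝ} {v₁ v₂ : ℝ≥0}
    (hX : P.map X = gaussianReal m₁ v₁) (hY : P.map Y = gaussianReal m₂ v₂) :
    P {ω | X ω > Y ω} = gaussianReal (m₁ - m₂) (v₁ + v₂) (Set.Ioi 0) := by
  have hnegY : P.map (-Y) = gaussianReal (-m₂) v₂ := by
    rw [← gaussianReal_map_neg, ← hY, Measure.map_map measurable_neg hYm]
    rfl
  have hindep : IndepFun X (-Y) P := hXY.comp measurable_id measurable_neg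
  rw [sub_eq_add_neg, ← gaussianReal_add_gaussianReal_of_indepFun hindep hX hnegY,
    Measure.map_apply (hXm.add hYm.neg) measurableSet_Ioi]
  congr 1
  ext ω
  simp

/-- Combiner C1 increases exploitation: with `μ₁ > μ₂`, scaling both variances down by a factor
`N > 1` strictly increases the probability that the larger-mean Gaussian exceeds the
smaller-mean one: `P(X' > Y') > P(X > Y)`. -/
theorem variance_shrink_increases_prob_optimal
    {Ω : Type*} [MeasureSpace Ω] [IsProbabilityMeasure (ℙ : Measure Ω)]
    (μ₁ μ₂ σ₁ σ₂ N : ℝ) (hμ : μ₁ > μ₂) (hσ₁ : 0 < σ₁) (hσ₂ : 0 < σ₂) (hN : 1 < N)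
    (X Y X' Y' : Ω → ℝ)
    (hXmeas : Measurable X) (hYmeas : Measurable Y)
    (hX'meas : Measurable X') (hY'meas : Measurable Y')
    (hindep : IndepFun X Y ℙ) (hindep' : IndepFun X' Y' ℙ)
    (hX : Measure.map X ℙ = gaussianReal μ₁ ⟨σ₁ ^ 2, sq_nonneg σ₁⟩)
    (hY : Measure.map Y ℙ = gaussianReal μ₂ ⟨σ₂ ^ 2, sq_nonneg σ₂⟩)
    (hX' : Measure.map X' ℙ =
      gaussianReal μ₁ ⟨σ₁ ^ 2 / N, div_nonneg (sq_nonneg σ₁) (by linarith)⟩)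
    (hY' : Measure.map Y' ℙ =
      gaussianReal μ₂ ⟨σ₂ ^ 2 / N, div_nonneg (sq_nonneg σ₂) (by linarith)⟩) :
    ℙ {ω | X' ω > Y' ω} > ℙ {ω | X ω > Y ω} := by
  rw [measure_gt_of_indepFun_gaussianReal hXmeas hYmeas hindep hX hY,
    measure_gt_of_indepFun_gaussianReal hX'meas hY'meas hindep' hX' hY']
  have hN₀ : 0 < N := by linarith
  refine gaussianReal_Ioi_zero_lt_of_lt (sub_pos.mpr hμ) ?_ ?_
  · refine ne_of_gt ?_
    rw [← NNReal.coe_pos]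
    change 0 < σ₁ ^ 2 / N + σ₂ ^ 2 / N
    positivity
  · rw [← NNReal.coe_lt_coe]
    change σ₁ ^ 2 / N + σ₂ ^ 2 / N < σ₁ ^ 2 + σ₂ ^ 2
    exact add_lt_add (div_lt_self (by positivity) hN) (div_lt_self (by positivity) hN)
end

section
/- Let γ > 0, let x < y be reals, let T ≥ 1 and Δ > 0 satisfy T·Δ² ≥ 1, and let k ≥ 0 be a real number with k ≥ 2·ln(T·Δ²)/(γ·(y − x)²). If ν is a Gaussian random variable with mean x and variance 1/(γ(k+1)), then P(ν > y) ≤ 1/(T·Δ²). -/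
open MeasureTheory ProbabilityTheory Real

/-- Chernoff bound on the upper tail of a Gaussian. -/
theorem gaussianReal_real_Ici_le_exp (m : ℝ) (v : NNReal) {y : ℝ} (hy : m ≤ y) :
    (gaussianReal m v).real {t | y ≤ t} ≤ exp (-(y - m) ^ 2 / (2 * v)) := by
  have chernoff := measure_ge_le_exp_mul_mgf (μ := gaussianReal m v) (X := id) (t := (y - m) / v) y
    (div_nonneg (sub_nonneg.2 hy) v.2) (integrable_exp_mul_gaussianReal _)
  rw [mgf_id_gaussianReal, ← exp_add] at chernoff
  refine chernoff.trans_eq ?_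
  rcases eq_or_ne (v : ℝ) 0 with hv | hv
  · simp [hv]
  · congr 1
    field_simp
    ring

/-- Key tail estimate of Lemma 2: if `k ≥ 2·ln(T·Δ²)/(γ·(y − x)²)` and `ν` is Gaussian with
mean `x` and variance `1/(γ(k+1))`, then `P(ν > y) ≤ 1/(T·Δ²)`. -/
theorem gaussian_threshold_tail_bound
    (γ x y T Δ k : ℝ) (hγ : 0 < γ) (hxy : x < y) (hT : 1 ≤ T) (hΔ : 0 < Δ)
    (hTΔ : 1 ≤ T * Δ ^ 2) (hk0 : 0 ≤ k)
    (hk : 2 * Real.log (T * Δ ^ 2) / (γ * (y - x) ^ 2) ≤ k) :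
    gaussianReal x ⟨1 / (γ * (k + 1)), div_nonneg zero_le_one
        (mul_nonneg hγ.le (by linarith))⟩ {t | t > y} ≤
      ENNReal.ofReal (1 / (T * Δ ^ 2)) := by
  have hsq : 0 < γ * (y - x) ^ 2 := mul_pos hγ (pow_pos (sub_pos.2 hxy) 2)
  rw [div_le_iff₀ hsq] at hk
  have main (v : NNReal) (hv : (v : ℝ) = 1 / (γ * (k + 1))) :
      gaussianReal x v {t | t > y} ≤ ENNReal.ofReal (1 / (T * Δ ^ 2)) := by
    refine (measure_mono fun t (ht : y < t) => ht.le : _ ≤ gaussianReal x v {t | y ≤ t}).trans ?_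
    rw [← ofReal_measureReal]
    refine ENNReal.ofReal_le_ofReal ((gaussianReal_real_Ici_le_exp x v hxy.le).trans ?_)
    rw [one_div (T * Δ ^ 2), ← exp_log (inv_pos.2 (zero_lt_one.trans_le hTΔ)), log_inv, exp_le_exp,
      hv]
    have hexp : -(y - x) ^ 2 / (2 * (1 / (γ * (k + 1)))) = -(γ * (y - x) ^ 2 * (k + 1) / 2) := by
      field_simp
    rw [hexp]
    linarith
  exact main _ rfl
end
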